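/- Let S ∈ 𝓜 and let μ be a Borel measure on ℝⁿ with μ(ℝⁿ \ S) = 0. Suppose there exists a family {F_ι}_{ι∈I} of compact subsets of S such that: (i) for every ι ∈ I, the d-dimensional Minkowski content Cont_d(F_ι) exists, equals μ(F_ι), and is finite; (ii) every compact set K ⊆ S is contained in some F_ι; and (iii) every compact set K ⊆ S can be written as K = ⋂_{m=1}^∞ J_m, where (J_m) is a decreasing sequence of sets each of which is a finite disjoint union of elements of {F_ι}_{ι∈I}. Then μ is the d-dimensional Minkowski content measure on S. -/

import Mathlib

open MeasureTheory Filter Metric Set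
open scoped ENNReal Topology NNReal

/-- `Cont_d(S;r) = r^(d-n) λⁿ(B(S,r))`, where `B(S,r)` is the closed `r`-neighborhood. -/
noncomputable def contApprox (n : ℕ) (d : ℝ) (S : Set (EuclideanSpace ℝ (Fin n))) (r : ℝ) :
    ℝ≥0∞ :=
  ENNReal.ofReal (r ^ (d - (n : ℝ))) * volume (cthickening r S)

/-- Upper `d`-dimensional Minkowski content. -/
noncomputable def upperCont (n : ℕ) (d : ℝ) (S : Set (EuclideanSpace ℝ (Fin n))) : ℝ≥0∞ :=
  Filter.limsup (contApprox n d S) (𝓝[>] (0 : ℝ))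

/-- Lower `d`-dimensional Minkowski content. -/
noncomputable def lowerCont (n : ℕ) (d : ℝ) (S : Set (EuclideanSpace ℝ (Fin n))) : ℝ≥0∞ :=
  Filter.liminf (contApprox n d S) (𝓝[>] (0 : ℝ))

/-- The `d`-dimensional Minkowski content of `S` exists and equals `c`. -/
def ContEq (n : ℕ) (d : ℝ) (S : Set (EuclideanSpace ℝ (Fin n))) (c : ℝ≥0∞) : Prop :=
  upperCont n d S = c ∧ lowerCont n d S = c

/-- The relative boundary `∂_S T = S ∩ cl(T) ∩ cl(S \ T)` of `T` in `S`. -/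
def relBdry {X : Type*} [TopologicalSpace X] (S T : Set X) : Set X :=
  S ∩ closure T ∩ closure (S \ T)

/-- `𝓜`: sets expressible as the intersection of an open set with a closed set. -/
def MemM (n : ℕ) (S : Set (EuclideanSpace ℝ (Fin n))) : Prop :=
  ∃ U F : Set (EuclideanSpace ℝ (Fin n)), IsOpen U ∧ IsClosed F ∧ S = U ∩ F

/-- `μ` is the `d`-dimensional Minkowski content measure on `S`. -/
def IsMinkowskiMeasure (n : ℕ) (d : ℝ) (S : Set (EuclideanSpace ℝ (Fin n)))
    (μ : Measure (EuclideanSpace ℝ (Fin n))) : Prop :=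
  μ Sᶜ = 0 ∧ ∀ K : Set (EuclideanSpace ℝ (Fin n)), K ⊆ S → IsCompact K →
    μ K < ⊤ ∧ (μ (relBdry S K) = 0 → ContEq n d K (μ K))

theorem ENNReal.limsup_add_le_limsup_add_limsup {α : Type*} {f : Filter α} (u v : α → ℝ≥0∞) :
    limsup (u + v) f ≤ limsup u f + limsup v f := by
  refine ENNReal.le_of_forall_pos_le_add fun ε hε hfin ↦ ?_
  obtain ⟨hu, hv⟩ := ENNReal.add_lt_top.1 hfin
  have hε2 : ((ε / 2 : ℝ≥0) : ℝ≥0∞) ≠ 0 := by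
    simpa using (half_pos hε).ne'
  have hu' := eventually_lt_of_limsup_lt (ENNReal.lt_add_right hu.ne hε2)
  have hv' := eventually_lt_of_limsup_lt (ENNReal.lt_add_right hv.ne hε2)
  refine limsup_le_of_le (by isBoundedDefault) ?_
  filter_upwards [hu', hv'] with x hx hy
  calc u x + v x ≤ (limsup u f + (ε / 2 : ℝ≥0)) + (limsup v f + (ε / 2 : ℝ≥0)) :=
        add_le_add hx.le hy.le
    _ = limsup u f + limsup v f + ((ε / 2 : ℝ≥0) + (ε / 2 : ℝ≥0)) := add_add_add_comm ..
    _ = limsup u f + limsup v f + ε := by rw [← ENNReal.coe_add, add_halves]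

theorem ENNReal.liminf_add_le_liminf_add_limsup {α : Type*} {f : Filter α} (u v : α → ℝ≥0∞) :
    liminf (u + v) f ≤ liminf u f + limsup v f := by
  refine ENNReal.le_of_forall_pos_le_add fun ε hε hfin ↦ ?_
  obtain ⟨hu, hv⟩ := ENNReal.add_lt_top.1 hfin
  have hε2 : ((ε / 2 : ℝ≥0) : ℝ≥0∞) ≠ 0 := by
    simpa using (half_pos hε).ne'
  have hu' := frequently_lt_of_liminf_lt (by isBoundedDefault) (ENNReal.lt_add_right hu.ne hε2)
  have hv' := eventually_lt_of_limsup_lt (ENNReal.lt_add_right hv.ne hε2)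
  refine liminf_le_of_frequently_le ((hu'.and_eventually hv').mono fun x hx ↦ ?_)
  calc u x + v x ≤ (liminf u f + (ε / 2 : ℝ≥0)) + (limsup v f + (ε / 2 : ℝ≥0)) :=
        add_le_add hx.1.le hx.2.le
    _ = liminf u f + limsup v f + ((ε / 2 : ℝ≥0) + (ε / 2 : ℝ≥0)) := add_add_add_comm ..
    _ = liminf u f + limsup v f + ε := by rw [← ENNReal.coe_add, add_halves]

section MinkowskiContent

variable {n : ℕ} {d : ℝ}

theorem contApprox_mono {S T : Set (EuclideanSpace ℝ (Fin n))} (h : S ⊆ T) (r : ℝ) :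
    contApprox n d S r ≤ contApprox n d T r :=
  mul_le_mul_right (measure_mono (cthickening_subset_of_subset r h)) _

theorem contApprox_union_le (S T : Set (EuclideanSpace ℝ (Fin n))) (r : ℝ) :
    contApprox n d (S ∪ T) r ≤ contApprox n d S r + contApprox n d T r := by
  simp only [contApprox, cthickening_union, ← mul_add]
  exact mul_le_mul_right (measure_union_le _ _) _

theorem upperCont_mono {S T : Set (EuclideanSpace ℝ (Fin n))} (h : S ⊆ T) :
    upperCont n d S ≤ upperCont n d T :=
  limsup_le_limsup (Eventually.of_forall (contApprox_mono h))

theorem lowerCont_mono {S T : Set (EuclideanSpace ℝ (Fin n))} (h : S ⊆ T) :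
    lowerCont n d S ≤ lowerCont n d T :=
  liminf_le_liminf (Eventually.of_forall (contApprox_mono h))

theorem lowerCont_le_upperCont (S : Set (EuclideanSpace ℝ (Fin n))) :
    lowerCont n d S ≤ upperCont n d S :=
  liminf_le_limsup

theorem upperCont_empty : upperCont n d ∅ = 0 := by
  have : contApprox n d ∅ = fun _ ↦ 0 := by
    funext r
    simp [contApprox]
  rw [upperCont, this, limsup_const]

theorem upperCont_union_le (S T : Set (EuclideanSpace ℝ (Fin n))) :
    upperCont n d (S ∪ T) ≤ upperCont n d S + upperCont n d T :=
  (limsup_le_limsup (Eventually.of_forall (contApprox_union_le S T))).trans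
    (ENNReal.limsup_add_le_limsup_add_limsup _ _)

theorem lowerCont_union_le (S T : Set (EuclideanSpace ℝ (Fin n))) :
    lowerCont n d (S ∪ T) ≤ lowerCont n d S + upperCont n d T :=
  (liminf_le_liminf (Eventually.of_forall (contApprox_union_le S T))).trans
    (ENNReal.liminf_add_le_liminf_add_limsup _ _)

theorem upperCont_sUnion_le (𝒥 : Finset (Set (EuclideanSpace ℝ (Fin n)))) :
    upperCont n d (⋃₀ (↑𝒥 : Set (Set (EuclideanSpace ℝ (Fin n))))) ≤
      ∑ A ∈ 𝒥, upperCont n d A := by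
  classical
  induction 𝒥 using Finset.induction_on with
  | empty => simp [upperCont_empty]
  | insert A 𝒥 hA ih =>
    rw [Finset.coe_insert, sUnion_insert, Finset.sum_insert hA]
    exact (upperCont_union_le _ _).trans (add_le_add_right ih _)

/-- The upper content of a finite disjoint union is at most its measure when this holds for
each piece. -/
theorem upperCont_sUnion_le_measure {μ : Measure (EuclideanSpace ℝ (Fin n))}
    {𝒥 : Finset (Set (EuclideanSpace ℝ (Fin n)))}
    (hd : (↑𝒥 : Set (Set (EuclideanSpace ℝ (Fin n)))).Pairwise Disjoint)
    (hm : ∀ A ∈ 𝒥, MeasurableSet A) (hle : ∀ A ∈ 𝒥, upperCont n d A ≤ μ A) :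
    upperCont n d (⋃₀ (↑𝒥 : Set (Set (EuclideanSpace ℝ (Fin n))))) ≤
      μ (⋃₀ (↑𝒥 : Set (Set (EuclideanSpace ℝ (Fin n))))) := by
  have hμ : μ (⋃₀ (↑𝒥 : Set (Set (EuclideanSpace ℝ (Fin n))))) = ∑ A ∈ 𝒥, μ A := by
    rw [sUnion_eq_biUnion]
    exact measure_biUnion_finset hd hm
  rw [hμ]
  exact (upperCont_sUnion_le 𝒥).trans (Finset.sum_le_sum hle)

theorem upperCont_iInter_le_measure {μ : Measure (EuclideanSpace ℝ (Fin n))}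
    {J : ℕ → Set (EuclideanSpace ℝ (Fin n))} (hJ : Antitone J) (hm : ∀ m, MeasurableSet (J m))
    (hfin : ∃ m, μ (J m) ≠ ⊤) (hle : ∀ m, upperCont n d (J m) ≤ μ (J m)) :
    upperCont n d (⋂ m, J m) ≤ μ (⋂ m, J m) :=
  ge_of_tendsto' (tendsto_measure_iInter_atTop (fun m ↦ (hm m).nullMeasurableSet) hJ hfin)
    fun m ↦ (upperCont_mono (iInter_subset J m)).trans (hle m)

/-- If the upper content is at most `μ` on compact subsets of `S`, a compact subset of `S` with
`μ`-null relative boundary has content `μ K` as soon as it lies in a compact subset of `S` whose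
content is its (finite) `μ`-measure. -/
theorem contEq_of_subset_of_upperCont_le {S K T : Set (EuclideanSpace ℝ (Fin n))}
    {μ : Measure (EuclideanSpace ℝ (Fin n))}
    (hle : ∀ L ⊆ S, IsCompact L → upperCont n d L ≤ μ L)
    (hKT : K ⊆ T) (hTS : T ⊆ S) (hK : IsCompact K) (hT : IsCompact T)
    (hcont : ContEq n d T (μ T)) (hfin : μ T < ⊤) (hbd : μ (relBdry S K) = 0) :
    ContEq n d K (μ K) := by
  set L := closure (T \ K)
  have hLT : L ⊆ T := closure_minimal sdiff_subset hT.isClosed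
  have hLsub : L ⊆ T \ K ∪ relBdry S K := by
    intro x hx
    by_cases hxK : x ∈ K
    · exact Or.inr ⟨⟨hTS (hLT hx), subset_closure hxK⟩, closure_mono (sdiff_subset_sdiff_left hTS) hx⟩
    · exact Or.inl ⟨hLT hx, hxK⟩
  have hL : upperCont n d L ≤ μ (T \ K) :=
    calc upperCont n d L ≤ μ L :=
          hle L (hLT.trans hTS) (hT.of_isClosed_subset isClosed_closure hLT)
      _ ≤ μ (T \ K) + μ (relBdry S K) := (measure_mono hLsub).trans (measure_union_le _ _)
      _ = μ (T \ K) := by rw [hbd, add_zero]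
  have hTsub : T ⊆ K ∪ L := fun x hx ↦
    (em (x ∈ K)).imp id fun hxK ↦ subset_closure ⟨hx, hxK⟩
  have hsum : μ K + μ (T \ K) ≤ lowerCont n d K + μ (T \ K) :=
    calc μ K + μ (T \ K) = lowerCont n d T := by
          rw [hcont.2, ← measure_union disjoint_sdiff_self_right
            (hT.measurableSet.diff hK.measurableSet), union_sdiff_cancel hKT]
      _ ≤ lowerCont n d K + upperCont n d L := (lowerCont_mono hTsub).trans (lowerCont_union_le K L)
      _ ≤ lowerCont n d K + μ (T \ K) := add_le_add_right hL _
  have hlow : μ K ≤ lowerCont n d K :=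
    (ENNReal.add_le_add_iff_right ((measure_mono sdiff_subset).trans_lt hfin).ne).1 hsum
  have hup : upperCont n d K ≤ μ K := hle K (hKT.trans hTS) hK
  exact ⟨hup.antisymm (hlow.trans (lowerCont_le_upperCont K)),
    ((lowerCont_le_upperCont K).trans hup).antisymm hlow⟩

end MinkowskiContent

/-- a criterion for being the Minkowski content measure via an exhausting family
of compact subsets. -/
theorem isMinkowskiMeasure_of_family (n : ℕ) (hn : 1 ≤ n) (d : ℝ) (hd0 : 0 < d) (hdn : d < n)
    (S : Set (EuclideanSpace ℝ (Fin n))) (hS : MemM n S)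
    (μ : Measure (EuclideanSpace ℝ (Fin n))) (hsupp : μ Sᶜ = 0)
    (I : Type) (F : I → Set (EuclideanSpace ℝ (Fin n)))
    (hFS : ∀ ι : I, F ι ⊆ S) (hFc : ∀ ι : I, IsCompact (F ι))
    (h1 : ∀ ι : I, ContEq n d (F ι) (μ (F ι)) ∧ μ (F ι) < ⊤)
    (h2 : ∀ K : Set (EuclideanSpace ℝ (Fin n)), K ⊆ S → IsCompact K → ∃ ι : I, K ⊆ F ι)
    (h3 : ∀ K : Set (EuclideanSpace ℝ (Fin n)), K ⊆ S → IsCompact K →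
      ∃ J : ℕ → Set (EuclideanSpace ℝ (Fin n)), Antitone J ∧ K = ⋂ m : ℕ, J m ∧
        ∀ m : ℕ, ∃ 𝒥 : Finset (Set (EuclideanSpace ℝ (Fin n))),
          (↑𝒥 : Set (Set (EuclideanSpace ℝ (Fin n)))).Pairwise Disjoint ∧
          (∀ A ∈ 𝒥, ∃ ι : I, A = F ι) ∧ J m = ⋃₀ (↑𝒥 : Set (Set (EuclideanSpace ℝ (Fin n)))) ) :
    IsMinkowskiMeasure n d S μ := by
  have hle : ∀ L ⊆ S, IsCompact L → upperCont n d L ≤ μ L := by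
    intro L hLS hL
    obtain ⟨J, hJ, rfl, hJF⟩ := h3 L hLS hL
    choose 𝒥 hdisj hmem hJeq using hJF
    have hm : ∀ m, ∀ A ∈ 𝒥 m, MeasurableSet A := by
      intro m A hA
      obtain ⟨ι, rfl⟩ := hmem m A hA
      exact (hFc ι).measurableSet
    refine upperCont_iInter_le_measure hJ (fun m ↦ ?_) ⟨0, ?_⟩ (fun m ↦ ?_)
    · rw [hJeq m]
      exact MeasurableSet.sUnion (𝒥 m).countable_toSet (hm m)
    · rw [hJeq 0, sUnion_eq_biUnion]
      refine (measure_biUnion_lt_top (𝒥 0).finite_toSet fun A hA ↦ ?_).ne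
      obtain ⟨ι, rfl⟩ := hmem 0 A hA
      exact (h1 ι).2
    · rw [hJeq m]
      refine upperCont_sUnion_le_measure (hdisj m) (hm m) fun A hA ↦ ?_
      obtain ⟨ι, rfl⟩ := hmem m A hA
      exact (h1 ι).1.1.le
  refine ⟨hsupp, fun K hKS hK ↦ ?_⟩
  obtain ⟨ι, hι⟩ := h2 K hKS hK
  exact ⟨(measure_mono hι).trans_lt (h1 ι).2, contEq_of_subset_of_upperCont_le hle hι (hFS ι) hK
    (hFc ι) (h1 ι).1 (h1 ι).2⟩
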